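/- Fix q ∈ (0,1). The function r ↦ W_q(−r) is strictly increasing on the interval (q, 1): for all r₁, r₂ with q < r₁ < r₂ < 1 one has W_q(−r₁) < W_q(−r₂). -/

import Mathlib

/-- `W_q(z)`: the Weierstrass ℘-function with periods `2π` and `-2i log q`,
evaluated at `-i log z`, as an explicit series. -/
noncomputable def W (q z : ℝ) : ℝ :=
  -1 / 12 - z / (1 - z) ^ 2 + 2 * ∑' n : ℕ, q ^ (2 * (n + 1)) / (1 - q ^ (2 * (n + 1))) ^ 2
    - ∑' n : ℕ, z * q ^ (2 * (n + 1)) / (1 - z * q ^ (2 * (n + 1))) ^ 2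
    - ∑' n : ℕ, (q ^ (2 * (n + 1)) / z) / (1 - q ^ (2 * (n + 1)) / z) ^ 2

/-- The rotated Koebe function `z / (1 + z)²`. -/
noncomputable def koebe (z : ℂ) : ℂ := z / (1 + z) ^ 2

/-- The sum of `koebe` over the forward orbit `q² z, q⁴ z, …`. -/
noncomputable def koebeOrbit (q : ℝ) (z : ℂ) : ℂ := ∑' n : ℕ, koebe (z * (q : ℂ) ^ (2 * (n + 1)))

/-- The part of the periodization of `koebe` which is regular at `-1`. -/
noncomputable def koebeTail (q : ℝ) (z : ℂ) : ℂ := koebeOrbit q z + koebeOrbit q z⁻¹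

/-- The sum of `koebe` over the two-sided orbit of `z` under multiplication by `q²`. -/
noncomputable def koebePeriodization (q : ℝ) (z : ℂ) : ℂ := koebe z + koebeTail q z

open scoped ComplexConjugate

theorem koebe_inv (z : ℂ) : koebe z⁻¹ = koebe z := by
  unfold koebe
  rcases eq_or_ne z 0 with rfl | hz
  · simp
  rcases eq_or_ne (1 + z) 0 with h | h
  · have : z = -1 := by linear_combination h
    subst this; norm_num
  · have h' : 1 + z⁻¹ = (1 + z) / z := by field_simp; ring
    rw [h']; field_simp

theorem conj_koebe (z : ℂ) : conj (koebe z) = koebe (conj z) := by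
  simp [koebe]

theorem koebe_ofReal (x : ℝ) : koebe x = ((x / (1 + x) ^ 2 : ℝ) : ℂ) := by
  simp [koebe]

theorem im_koebe (z : ℂ) : (koebe z).im = z.im * (1 - ‖z‖ ^ 2) / (‖1 + z‖ ^ 2) ^ 2 := by
  rcases eq_or_ne (1 + z) 0 with h | h
  · simp [koebe, h]
  have h2 : ‖1 + z‖ ^ 2 ≠ 0 := by simpa using h
  have : koebe z = z * conj (1 + z) ^ 2 / (((‖1 + z‖ ^ 2) ^ 2 : ℝ) : ℂ) := by
    have e : (((‖1 + z‖ ^ 2) ^ 2 : ℝ) : ℂ) = ((1 + z) * conj (1 + z)) ^ 2 := by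
      rw [Complex.mul_conj']; push_cast; rfl
    have h3 : conj (1 + z) ≠ 0 := by simpa only [ne_eq, map_eq_zero] using h
    rw [e, koebe]; field_simp
  rw [this, Complex.div_ofReal_im]
  congr 1
  rw [Complex.sq_norm, Complex.normSq_apply]
  simp [pow_two]
  ring

theorem one_add_ne_zero_of_norm_lt {z : ℂ} (hz : ‖z‖ < 1) : 1 + z ≠ 0 := by
  intro h
  have : z = -1 := by linear_combination h
  simp [this] at hz

theorem differentiableAt_koebe {z : ℂ} (hz : 1 + z ≠ 0) : DifferentiableAt ℂ koebe z := by
  unfold koebe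
  fun_prop (disch := exact pow_ne_zero 2 hz)

theorem norm_koebe_le {z : ℂ} {ρ : ℝ} (hρ : ρ < 1) (hz : ‖z‖ ≤ ρ) :
    ‖koebe z‖ ≤ ‖z‖ / (1 - ρ) ^ 2 := by
  have h : 1 - ρ ≤ ‖1 + z‖ := by
    have := norm_sub_norm_le (1 : ℂ) (-z)
    simp only [norm_one, norm_neg, sub_neg_eq_add] at this
    linarith
  have : 0 < 1 - ρ := by linarith
  rw [koebe, norm_div, norm_pow]
  gcongr

section
variable {q : ℝ}

theorem norm_mul_ofReal_pow (h0 : 0 < q) (z : ℂ) (n : ℕ) :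
    ‖z * (q : ℂ) ^ (2 * (n + 1))‖ = ‖z‖ * q ^ 2 * (q ^ 2) ^ n := by
  rw [norm_mul, norm_pow, Complex.norm_real, Real.norm_of_nonneg h0.le, ← pow_mul]
  ring

theorem norm_koebe_orbit_le (h0 : 0 < q) (h1 : q < 1) {M : ℝ} (hM : M * q ^ 2 < 1) {z : ℂ}
    (hz : ‖z‖ ≤ M) (n : ℕ) :
    ‖koebe (z * (q : ℂ) ^ (2 * (n + 1)))‖ ≤ (q ^ 2) ^ n * (1 / (1 - M * q ^ 2) ^ 2) := by
  have hp : (q ^ 2) ^ n ≤ 1 := pow_le_one₀ (by positivity) (by nlinarith)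
  have hp0 : 0 ≤ (q ^ 2) ^ n := by positivity
  have hn := norm_mul_ofReal_pow h0 z n
  have hzq : ‖z‖ * q ^ 2 ≤ M * q ^ 2 := by gcongr
  have hzq0 : 0 ≤ ‖z‖ * q ^ 2 := by positivity
  refine (norm_koebe_le hM (hn.trans_le ?_)).trans ?_
  · nlinarith
  · rw [hn, mul_one_div]
    gcongr
    nlinarith

theorem summable_geometric_sq_mul (h0 : 0 < q) (h1 : q < 1) (C : ℝ) :
    Summable fun n : ℕ => (q ^ 2) ^ n * C :=
  (summable_geometric_of_lt_one (by positivity) (by nlinarith)).mul_right C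

theorem summable_koebe_orbit (h0 : 0 < q) (h1 : q < 1) {z : ℂ} (hz : ‖z‖ * q ^ 2 < 1) :
    Summable fun n : ℕ => koebe (z * (q : ℂ) ^ (2 * (n + 1))) :=
  Summable.of_norm_bounded (summable_geometric_sq_mul h0 h1 _)
    fun n => norm_koebe_orbit_le h0 h1 hz le_rfl n

theorem differentiableAt_koebeOrbit (h0 : 0 < q) (h1 : q < 1) {z : ℂ} (hz : ‖z‖ * q ^ 2 < 1) :
    DifferentiableAt ℂ (koebeOrbit q) z := by
  obtain ⟨M, hzM, hM⟩ := exists_between ((lt_div_iff₀ (by positivity)).2 hz)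
  rw [lt_div_iff₀ (by positivity)] at hM
  have hq2 : q ^ 2 ≤ 1 := by nlinarith
  have : DifferentiableOn ℂ (koebeOrbit q) (Metric.ball 0 M) := by
    refine Complex.differentiableOn_tsum_of_summable_norm
      (summable_geometric_sq_mul h0 h1 (1 / (1 - M * q ^ 2) ^ 2)) (fun n w hw => ?_)
      Metric.isOpen_ball fun n w hw => norm_koebe_orbit_le h0 h1 hM (mem_ball_zero_iff.1 hw).le n
    rw [mem_ball_zero_iff] at hw
    refine (DifferentiableAt.comp w (differentiableAt_koebe (one_add_ne_zero_of_norm_lt ?_))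
      (by fun_prop)).differentiableWithinAt
    rw [norm_mul_ofReal_pow h0]
    have hw' : ‖w‖ * q ^ 2 < 1 := lt_of_le_of_lt (by gcongr) hM
    have hp : (q ^ 2) ^ n ≤ 1 := pow_le_one₀ (by positivity) hq2
    have hw0 : 0 ≤ ‖w‖ * q ^ 2 := by positivity
    nlinarith
  exact this.differentiableAt (Metric.isOpen_ball.mem_nhds (mem_ball_zero_iff.2 hzM))

theorem differentiableAt_koebeTail (h0 : 0 < q) (h1 : q < 1) {z : ℂ} (hz : ‖z‖ * q ^ 2 < 1)
    (hz' : q ^ 2 < ‖z‖) : DifferentiableAt ℂ (koebeTail q) z := by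
  have hpos : 0 < ‖z‖ := lt_trans (by positivity) hz'
  refine (differentiableAt_koebeOrbit h0 h1 hz).add
    (DifferentiableAt.comp z (differentiableAt_koebeOrbit h0 h1 ?_)
      (differentiableAt_inv (norm_pos_iff.1 hpos)))
  rw [norm_inv, inv_mul_lt_iff₀ hpos]
  linarith

theorem differentiableAt_koebePeriodization (h0 : 0 < q) (h1 : q < 1) {z : ℂ}
    (hz : ‖z‖ * q ^ 2 < 1) (hz' : q ^ 2 < ‖z‖) (hz1 : 1 + z ≠ 0) :
    DifferentiableAt ℂ (koebePeriodization q) z :=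
  (differentiableAt_koebe hz1).add (differentiableAt_koebeTail h0 h1 hz hz')

theorem conj_koebeOrbit (q : ℝ) (z : ℂ) : conj (koebeOrbit q z) = koebeOrbit q (conj z) := by
  simp only [koebeOrbit, Complex.conj_tsum, conj_koebe, map_mul, map_pow, Complex.conj_ofReal]

theorem im_koebeTail_of_norm_eq_one {z : ℂ} (hz : ‖z‖ = 1) : (koebeTail q z).im = 0 := by
  rw [koebeTail, Complex.inv_eq_conj hz, ← conj_koebeOrbit]
  simp

theorem im_koebePeriodization_of_norm_eq_one {z : ℂ} (hz : ‖z‖ = 1) :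
    (koebePeriodization q z).im = 0 := by
  simp [koebePeriodization, im_koebeTail_of_norm_eq_one hz, im_koebe, hz]

theorem im_koebePeriodization_of_norm_eq (h0 : 0 < q) (h1 : q < 1) {z : ℂ} (hz : ‖z‖ = q) :
    (koebePeriodization q z).im = 0 := by
  have hz0 : z ≠ 0 := by rw [← norm_pos_iff, hz]; exact h0
  have hs := summable_koebe_orbit h0 h1 (z := z) (by rw [hz]; nlinarith [mul_pos h0 h0])
  have e1 : koebe z + koebeOrbit q z = ∑' n : ℕ, koebe (z * (q : ℂ) ^ (2 * n)) := by
    have hs' : Summable fun n : ℕ => koebe (z * (q : ℂ) ^ (2 * n)) :=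
      (summable_nat_add_iff (f := fun n : ℕ => koebe (z * (q : ℂ) ^ (2 * n))) 1).1 hs
    rw [hs'.tsum_eq_zero_add, mul_zero, pow_zero, mul_one, koebeOrbit]
  have e2 : koebeOrbit q z⁻¹ = conj (koebe z + koebeOrbit q z) := by
    rw [e1, Complex.conj_tsum, koebeOrbit]
    refine tsum_congr fun n => ?_
    rw [conj_koebe]
    congr 1
    have hc : z * conj z = (q : ℂ) ^ 2 := by rw [Complex.mul_conj', hz]
    rw [map_mul, map_pow, Complex.conj_ofReal, mul_add, pow_add, mul_one, ← hc]
    field_simp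
  rw [koebePeriodization, koebeTail, ← add_assoc, e2, Complex.add_im, Complex.conj_im, add_neg_cancel]

theorem im_koebePeriodization_of_im_eq_zero {z : ℂ} (hz : z.im = 0) :
    (koebePeriodization q z).im = 0 := by
  rw [← Complex.conj_eq_iff_im] at hz ⊢
  simp only [koebePeriodization, koebeTail, map_add, conj_koebe, conj_koebeOrbit, map_inv₀, hz]

/-- The maximum principle on a half-annulus, away from the pole at `-1`. -/
theorem im_koebePeriodization_nonneg (h0 : 0 < q) (h1 : q < 1) {z : ℂ} (hz : q < ‖z‖)
    (hz' : ‖z‖ < 1) (hzi : 0 < z.im) : 0 ≤ (koebePeriodization q z).im := by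
  refine le_of_forall_pos_lt_add fun δ hδ => ?_
  have hq2 : q ^ 2 < q := by nlinarith
  have hcont : ContinuousAt (fun w => (koebeTail q w).im) (-1) :=
    Complex.continuous_im.continuousAt.comp
      (differentiableAt_koebeTail h0 h1 (by rw [norm_neg, norm_one]; linarith)
        (by rw [norm_neg, norm_one]; linarith)).continuousAt
  obtain ⟨ε, hε, hball⟩ := Metric.continuousAt_iff.1 hcont (δ / 2) (by positivity)
  rw [im_koebeTail_of_norm_eq_one (by simp)] at hball
  have hz1 : 0 < ‖1 + z‖ := by
    rw [norm_pos_iff]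
    intro h
    have := congrArg Complex.im h
    simp at this
    linarith
  set η := min (ε / 2) (‖1 + z‖ / 2)
  have hη0 : 0 < η := by positivity
  set U : Set ℂ := {w | q < ‖w‖ ∧ ‖w‖ < 1 ∧ 0 < w.im ∧ η < ‖1 + w‖} with hU
  set K : Set ℂ := {w | q ≤ ‖w‖ ∧ ‖w‖ ≤ 1 ∧ 0 ≤ w.im ∧ η ≤ ‖1 + w‖} with hK
  have hUo : IsOpen U := by
    simp only [hU, Set.ofPred_and]
    exact (isOpen_lt (by fun_prop) (by fun_prop)).inter <|
      (isOpen_lt (by fun_prop) (by fun_prop)).inter <|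
      (isOpen_lt (by fun_prop) Complex.continuous_im).inter (isOpen_lt (by fun_prop) (by fun_prop))
  have hKc : IsClosed K := by
    simp only [hK, Set.ofPred_and]
    exact (isClosed_le (by fun_prop) (by fun_prop)).inter <|
      (isClosed_le (by fun_prop) (by fun_prop)).inter <|
      (isClosed_le (by fun_prop) Complex.continuous_im).inter
        (isClosed_le (by fun_prop) (by fun_prop))
  have hUK : closure U ⊆ K :=
    closure_minimal (fun w hw => ⟨hw.1.le, hw.2.1.le, hw.2.2.1.le, hw.2.2.2.le⟩) hKc
  have hb : Bornology.IsBounded U :=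
    (Metric.isBounded_closedBall (x := (0 : ℂ)) (r := 1)).subset fun w hw => by
      simpa using hw.2.1.le
  have hd : DiffContOnCl ℂ (fun w => Complex.exp (Complex.I * koebePeriodization q w)) U := by
    refine DifferentiableOn.diffContOnCl fun w hw => ?_
    obtain ⟨a, b, -, d⟩ := hUK hw
    refine DifferentiableAt.differentiableWithinAt
      (((differentiableAt_koebePeriodization h0 h1 ?_ ?_ ?_).const_mul _).cexp)
    · nlinarith
    · linarith
    · exact norm_pos_iff.1 (hη0.trans_le d)
  have hnorm (w : ℂ) : ‖Complex.exp (Complex.I * koebePeriodization q w)‖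
      = Real.exp (-(koebePeriodization q w).im) := by
    simp [Complex.norm_exp]
  have key := Complex.norm_le_of_forall_mem_frontier_norm_le hb hd (C := Real.exp (δ / 2))
    (fun w hw => ?_) (subset_closure (show z ∈ U from ⟨hz, hz', hzi,
      (min_le_right _ _).trans_lt (by linarith)⟩))
  · rw [hnorm, Real.exp_le_exp] at key
    linarith
  · rw [hnorm, Real.exp_le_exp]
    rw [hUo.frontier_eq] at hw
    obtain ⟨a, b, c, d⟩ := hUK hw.1
    rcases a.eq_or_lt with a' | a'
    · rw [im_koebePeriodization_of_norm_eq h0 h1 a'.symm]; linarith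
    rcases b.eq_or_lt with b' | b'
    · rw [im_koebePeriodization_of_norm_eq_one b']; linarith
    rcases c.eq_or_lt with c' | c'
    · rw [im_koebePeriodization_of_im_eq_zero c'.symm]; linarith
    have d' : ‖1 + w‖ = η := le_antisymm (not_lt.1 fun h => hw.2 ⟨a', b', c', h⟩) d
    have hk : 0 ≤ (koebe w).im := by
      rw [im_koebe]
      have : 0 ≤ 1 - ‖w‖ ^ 2 := by nlinarith [norm_nonneg w]
      positivity
    have ht := hball (x := w) (by
      rw [dist_eq_norm, sub_neg_eq_add, add_comm, d']
      exact (min_le_left _ _).trans_lt (by linarith))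
    rw [Real.dist_eq, sub_zero, abs_lt] at ht
    rw [koebePeriodization, Complex.add_im]
    linarith [ht.1]

theorem re_deriv_koebePeriodization_nonneg (h0 : 0 < q) (h1 : q < 1) {r : ℝ} (hr : q < r)
    (hr' : r < 1) {d : ℂ} (hd : HasDerivAt (koebePeriodization q) d r) : 0 ≤ d.re := by
  have hline : HasDerivAt (fun y : ℝ => (r : ℂ) + y * Complex.I) Complex.I 0 := by
    simpa using ((Complex.ofRealCLM.hasDerivAt (x := (0 : ℝ))).mul_const Complex.I).const_add (r : ℂ)
  have hcomp : HasDerivAt (fun y : ℝ => koebePeriodization q (r + y * Complex.I))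
      (d * Complex.I) 0 :=
    HasDerivAt.comp (h₂ := koebePeriodization q) (0 : ℝ) (by simpa using hd) hline
  have him : HasDerivAt (fun y : ℝ => (koebePeriodization q (r + y * Complex.I)).im) d.re 0 := by
    simpa [Function.comp_def] using Complex.imCLM.hasFDerivAt.comp_hasDerivAt (0 : ℝ) hcomp
  have hnorm : ContinuousAt (fun y : ℝ => ‖(r : ℂ) + y * Complex.I‖) 0 := by fun_prop
  have hr0 : ‖(r : ℂ) + (0 : ℝ) * Complex.I‖ = r := by simp [abs_of_pos (h0.trans hr)]
  have hlim := (hasDerivAt_iff_tendsto_slope.1 him).mono_left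
    (nhdsWithin_mono (0 : ℝ) (fun y (hy : y ∈ Set.Ioi (0 : ℝ)) => ne_of_gt hy))
  refine ge_of_tendsto hlim ?_
  have ev : ∀ᶠ y : ℝ in nhds 0, q < ‖(r : ℂ) + y * Complex.I‖ ∧ ‖(r : ℂ) + y * Complex.I‖ < 1 :=
    (hnorm.eventually_const_lt (hr.trans_eq hr0.symm)).and
      (hnorm.eventually_lt_const (hr0.trans_lt hr'))
  filter_upwards [self_mem_nhdsWithin, nhdsWithin_le_nhds ev] with y hy h
  have hy : 0 < y := hy
  rw [slope_def_field]
  have hz : (koebePeriodization q (r + (0 : ℝ) * Complex.I)).im = 0 :=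
    im_koebePeriodization_of_im_eq_zero (by simp)
  rw [hz, sub_zero, sub_zero]
  exact div_nonneg (im_koebePeriodization_nonneg h0 h1 h.1 h.2 (by simpa using hy)) hy.le

theorem isPreconnected_annulus {a b : ℝ} (ha : 0 < a) :
    IsPreconnected {z : ℂ | a < ‖z‖ ∧ ‖z‖ < b} := by
  rcases le_or_gt b 0 with hb | hb
  · convert isPreconnected_empty using 1
    ext z
    simp only [Set.mem_ofPred_eq, Set.mem_empty_iff_false, iff_false]
    intro h
    linarith
  have : {z : ℂ | a < ‖z‖ ∧ ‖z‖ < b}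
      = Complex.exp '' (Complex.re ⁻¹' Set.Ioo (Real.log a) (Real.log b)) := by
    ext z
    constructor
    · rintro ⟨h, h'⟩
      have hz : 0 < ‖z‖ := ha.trans h
      refine ⟨Complex.log z, ?_, Complex.exp_log (norm_pos_iff.1 hz)⟩
      rw [Set.mem_preimage, Complex.log_re]
      exact ⟨Real.log_lt_log ha h, Real.log_lt_log hz h'⟩
    · rintro ⟨w, ⟨h, h'⟩, rfl⟩
      rw [Set.mem_ofPred_eq, Complex.norm_exp]
      exact ⟨(Real.log_lt_iff_lt_exp ha).1 h, (Real.lt_log_iff_exp_lt hb).1 h'⟩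
  rw [this]
  exact (((convex_Ioo _ _).linear_preimage Complex.reLm).isPreconnected).image _
    Complex.continuous_exp.continuousOn

theorem koebePeriodization_not_eqOn_const (h0 : 0 < q) (h1 : q < 1) {a b : ℝ} (ha : q < a)
    (hab : a < b) (hb : b < 1) (C : ℂ) :
    ¬ ∀ r : ℝ, r ∈ Set.Ioo a b → koebePeriodization q r = C := by
  intro hC
  have hq2 : q ^ 2 < q := by nlinarith
  have hq2' : 0 < q ^ 2 := by positivity
  set A : Set ℂ := {z | q ^ 2 < ‖z‖ ∧ ‖z‖ < (q ^ 2)⁻¹} with hA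
  have hAo : IsOpen A := by
    simp only [hA, Set.ofPred_and]
    exact (isOpen_lt (by fun_prop) (by fun_prop)).inter (isOpen_lt (by fun_prop) (by fun_prop))
  have hA1 {z : ℂ} (hz : q ^ 2 < ‖z‖) (hz' : ‖z‖ ≤ 1) : z ∈ A :=
    ⟨hz, hz'.trans_lt ((one_lt_inv₀ hq2').2 (by linarith))⟩
  have hf : AnalyticOnNhd ℂ (fun z => z + (1 + z) ^ 2 * koebeTail q z) A := by
    refine DifferentiableOn.analyticOnNhd (fun z hz => ?_) hAo
    have := differentiableAt_koebeTail h0 h1 (z := z)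
      ((lt_div_iff₀ hq2').1 (by simpa using hz.2)) hz.1
    exact DifferentiableAt.differentiableWithinAt (by fun_prop)
  have hg : AnalyticOnNhd ℂ (fun z : ℂ => C * (1 + z) ^ 2) A :=
    DifferentiableOn.analyticOnNhd (by fun_prop) hAo
  obtain ⟨m, hm⟩ := exists_between hab
  have hm0 : 0 < m := by linarith [hm.1]
  have hfreq : ∃ᶠ z in nhdsWithin (m : ℂ) {(m : ℂ)}ᶜ,
      z + (1 + z) ^ 2 * koebeTail q z = C * (1 + z) ^ 2 := by
    have ht : Filter.Tendsto (fun x : ℝ => (x : ℂ)) (nhdsWithin m {m}ᶜ)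
        (nhdsWithin (m : ℂ) {(m : ℂ)}ᶜ) :=
      tendsto_nhdsWithin_of_tendsto_nhds_of_eventually_within _
        (Complex.continuous_ofReal.continuousAt.mono_left nhdsWithin_le_nhds)
        (by filter_upwards [self_mem_nhdsWithin] with x hx using by simpa using hx)
    refine ht.frequently (Filter.Eventually.frequently ?_)
    filter_upwards [nhdsWithin_le_nhds (isOpen_Ioo.mem_nhds hm)] with x hx
    have hx0 : (1 + x : ℂ) ≠ 0 := by
      have : 1 + x ≠ 0 := by linarith [hx.1]
      exact_mod_cast this
    have := hC x hx
    rw [koebePeriodization, koebe] at this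
    rw [← this]
    field_simp
  have := hf.eqOn_of_preconnected_of_frequently_eq hg (isPreconnected_annulus hq2')
    (hA1 (z := m) (by simp [abs_of_pos hm0]; linarith [hm.1])
      (by simp [abs_of_pos hm0]; linarith [hm.2])) hfreq
    (hA1 (z := -1) (by rw [norm_neg, norm_one]; linarith) (by simp))
  simp at this

theorem strictMonoOn_re_koebePeriodization (h0 : 0 < q) (h1 : q < 1) :
    StrictMonoOn (fun r : ℝ => (koebePeriodization q r).re) (Set.Ioo q 1) := by
  have hder {r : ℝ} (hr : r ∈ Set.Ioo q 1) :
      HasDerivAt (fun r : ℝ => (koebePeriodization q r).re)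
        (deriv (koebePeriodization q) r).re r := by
    have hr0 : 0 < r := h0.trans hr.1
    have hn : ‖(r : ℂ)‖ = r := by simp [abs_of_pos hr0]
    refine (differentiableAt_koebePeriodization h0 h1 ?_ ?_ ?_).hasDerivAt.real_of_complex
    · rw [hn]; nlinarith [hr.2]
    · rw [hn]; nlinarith [hr.1]
    · have : 1 + r ≠ 0 := by linarith
      exact_mod_cast this
  have hmono : MonotoneOn (fun r : ℝ => (koebePeriodization q r).re) (Set.Ioo q 1) := by
    refine monotoneOn_of_deriv_nonneg (convex_Ioo q 1)
      (fun r hr => (hder hr).continuousAt.continuousWithinAt)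
      (fun r hr => (hder (interior_subset hr)).differentiableAt.differentiableWithinAt)
      fun r hr => ?_
    have hr := interior_subset hr
    rw [(hder hr).deriv]
    have hr0 : 0 < r := h0.trans hr.1
    have hn : ‖(r : ℂ)‖ = r := by simp [abs_of_pos hr0]
    refine re_deriv_koebePeriodization_nonneg h0 h1 hr.1 hr.2
      (differentiableAt_koebePeriodization h0 h1 ?_ ?_ ?_).hasDerivAt
    · rw [hn]; nlinarith [hr.2]
    · rw [hn]; nlinarith [hr.1]
    · have : 1 + r ≠ 0 := by linarith
      exact_mod_cast this
  intro a ha b hb hab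
  refine (hmono ha hb hab.le).lt_of_ne fun heq => ?_
  refine koebePeriodization_not_eqOn_const h0 h1 ha.1 hab hb.2 (koebePeriodization q a)
    fun r hr => ?_
  have hrI : r ∈ Set.Ioo q 1 := ⟨ha.1.trans hr.1, hr.2.trans hb.2⟩
  refine Complex.ext (le_antisymm ((hmono hrI hb hr.2.le).trans heq.ge) (hmono ha hrI hr.1.le)) ?_
  rw [im_koebePeriodization_of_im_eq_zero (by simp), im_koebePeriodization_of_im_eq_zero (by simp)]

theorem koebeOrbit_ofReal (q x : ℝ) : koebeOrbit q x =
    ((∑' n : ℕ, x * q ^ (2 * (n + 1)) / (1 + x * q ^ (2 * (n + 1))) ^ 2 : ℝ) : ℂ) := by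
  rw [koebeOrbit, Complex.ofReal_tsum]
  refine tsum_congr fun n => ?_
  rw [← koebe_ofReal]
  push_cast
  rfl

theorem W_neg (q r : ℝ) : W q (-r) = -1 / 12
    + 2 * ∑' n : ℕ, q ^ (2 * (n + 1)) / (1 - q ^ (2 * (n + 1))) ^ 2
    + (koebePeriodization q r).re := by
  rw [koebePeriodization, koebeTail, ← Complex.ofReal_inv, koebeOrbit_ofReal, koebeOrbit_ofReal,
    koebe_ofReal, ← Complex.ofReal_add, ← Complex.ofReal_add, Complex.ofReal_re, W]
  have e1 (n : ℕ) : -r * q ^ (2 * (n + 1)) / (1 - -r * q ^ (2 * (n + 1))) ^ 2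
      = -(r * q ^ (2 * (n + 1)) / (1 + r * q ^ (2 * (n + 1))) ^ 2) := by
    rw [neg_mul, sub_neg_eq_add, neg_div]
  have e2 (n : ℕ) : (q ^ (2 * (n + 1)) / -r) / (1 - q ^ (2 * (n + 1)) / -r) ^ 2
      = -(r⁻¹ * q ^ (2 * (n + 1)) / (1 + r⁻¹ * q ^ (2 * (n + 1))) ^ 2) := by
    rw [div_neg, sub_neg_eq_add, neg_div, div_eq_inv_mul (q ^ _) r]
  simp only [e1, e2, tsum_neg]
  ring

end

/-- `r ↦ W_q(-r)` is strictly increasing on `(q, 1)`. -/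
theorem W_strictMono (q : ℝ) (hq : q ∈ Set.Ioo (0 : ℝ) 1) :
    ∀ r₁ r₂ : ℝ, q < r₁ → r₁ < r₂ → r₂ < 1 → W q (-r₁) < W q (-r₂) := by
  intro r₁ r₂ h₁ h₁₂ h₂
  rw [W_neg, W_neg]
  gcongr
  exact strictMonoOn_re_koebePeriodization hq.1 hq.2 ⟨h₁, h₁₂.trans h₂⟩ ⟨h₁.trans h₁₂, h₂⟩ h₁₂
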